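/- Let E ⊆ Sym²(ℝⁿ) be a linear subspace with E ∩ 𝒫 = {0} (a basic edge subspace), n ≥ 1. Then 𝒫⁺ := E + 𝒫 is a convex cone subequation whose edge 𝒫⁺ ∩ (−𝒫⁺) equals exactly E and whose dual span S = span((𝒫⁺)₊) equals E^⊥. Moreover 𝒫⁺ is minimal among subequations with edge E: every convex cone subequation Q ⊆ Sym²(ℝⁿ) whose edge Q ∩ (−Q) equals E satisfies 𝒫⁺ ⊆ Q. -/

import Mathlib

open Matrix Set Pointwise

noncomputable section

/-- `Sym²(ℝⁿ)`: the space of real symmetric `n × n` matrices,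
realized as the self-adjoint elements of the matrix algebra. -/
abbrev SymMat (n : ℕ) : Type := ↥(selfAdjoint (Matrix (Fin n) (Fin n) ℝ))

namespace SymMat

variable {n : ℕ}

/-- The trace inner product `⟨A, B⟩ = tr (A * B)` on `Sym²(ℝⁿ)`. -/
def tinner (A B : SymMat n) : ℝ :=
  ((A : Matrix (Fin n) (Fin n) ℝ) * (B : Matrix (Fin n) (Fin n) ℝ)).trace

/-- `𝒫`: the closed convex cone of positive semidefinite matrices. -/
def Psd (n : ℕ) : Set (SymMat n) :=
  {A | (A : Matrix (Fin n) (Fin n) ℝ).PosSemidef}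

/-- The set of positive definite matrices (= `Int 𝒫`). -/
def Pd (n : ℕ) : Set (SymMat n) :=
  {A | (A : Matrix (Fin n) (Fin n) ℝ).PosDef}

/-- A convex cone subequation: a closed convex cone `F ⊆ Sym²(ℝⁿ)` which is a nonempty
proper subset and satisfies the positivity condition `F + 𝒫 = F`. -/
structure IsSubequation (F : Set (SymMat n)) : Prop where
  nonempty : F.Nonempty
  proper : F ≠ Set.univ
  isClosed : IsClosed F
  convex : Convex ℝ F
  cone : ∀ t : ℝ, 0 ≤ t → ∀ A ∈ F, t • A ∈ F
  positivity : ∀ A ∈ F, ∀ P ∈ Psd n, A + P ∈ F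

/-- The polar cone `F₊ = {B : ⟨A,B⟩ ≥ 0 ∀ A ∈ F}`. -/
def polarCone (F : Set (SymMat n)) : Set (SymMat n) :=
  {B | ∀ A ∈ F, 0 ≤ tinner A B}

/-- The edge `E = F ∩ (−F)`. -/
def edge (F : Set (SymMat n)) : Set (SymMat n) := F ∩ (-F)

/-- Orthogonal complement (as a set) with respect to the trace inner product. -/
def orthSet (E : Set (SymMat n)) : Set (SymMat n) :=
  {B | ∀ A ∈ E, tinner A B = 0}

/-- `P_e = e eᵀ`, orthogonal projection onto the line spanned by `e`, as a symmetric matrix. -/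
def lineProj (e : EuclideanSpace ℝ (Fin n)) : SymMat n :=
  ⟨Matrix.vecMulVec (WithLp.equiv 2 (Fin n → ℝ) e) (WithLp.equiv 2 (Fin n → ℝ) e), by
    refine selfAdjoint.mem_iff.mpr ?_
    ext i j
    simp [Matrix.conjTranspose_apply, Matrix.vecMulVec_apply, mul_comm]⟩

/-- The matrix `P_W` of the orthogonal projection onto a subspace `W ⊆ ℝⁿ`. -/
def projMat (W : Submodule ℝ (EuclideanSpace ℝ (Fin n))) : Matrix (Fin n) (Fin n) ℝ :=
  Matrix.toEuclideanLin.symm ((W.subtypeL.comp (Submodule.orthogonalProjection W)).toLinearMap)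

/-- `Sym²(W) = {A : A = P_W A P_W}`. -/
def symOn (W : Submodule ℝ (EuclideanSpace ℝ (Fin n))) : Set (SymMat n) :=
  {A | (A : Matrix (Fin n) (Fin n) ℝ) = projMat W * A * projMat W}

/-- The restriction `F_W = {P_W A P_W : A ∈ F}` of `F` to `W` (inside `Sym²(W)`). -/
def restrictTo (F : Set (SymMat n)) (W : Submodule ℝ (EuclideanSpace ℝ (Fin n))) :
    Set (SymMat n) :=
  {B | ∃ A ∈ F, (B : Matrix (Fin n) (Fin n) ℝ) = projMat W * A * projMat W}

/-- `F` is extremely degenerate: the polar cone only involves the variables of some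
proper subspace `W ⊊ ℝⁿ`. -/
def IsExtremelyDegenerate (F : Set (SymMat n)) : Prop :=
  ∃ W : Submodule ℝ (EuclideanSpace ℝ (Fin n)), W ≠ ⊤ ∧ polarCone F ⊆ symOn W

/-- `F` is (dimensionally) complete. -/
def IsComplete (F : Set (SymMat n)) : Prop := ¬ IsExtremelyDegenerate F

/-- The interior of `F` relative to `S`. -/
def relInt (S F : Set (SymMat n)) : Set (SymMat n) :=
  {B | B ∈ S ∧ ∃ U : Set (SymMat n), IsOpen U ∧ B ∈ U ∧ U ∩ S ⊆ F}

/-- The support of `F`: the intersection of all subspaces `W'` with `F₊ ⊆ Sym²(W')`. -/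
def support (F : Set (SymMat n)) : Submodule ℝ (EuclideanSpace ℝ (Fin n)) :=
  sInf {W | polarCone F ⊆ symOn W}

/-- The polar cone of `G` taken within `Sym²(W)`. -/
def polarIn (G : Set (SymMat n)) (W : Submodule ℝ (EuclideanSpace ℝ (Fin n))) :
    Set (SymMat n) :=
  {B | B ∈ symOn W ∧ ∀ A ∈ G, 0 ≤ tinner A B}

end SymMat

namespace SymMat

/-- The inclusion of symmetric matrices into matrices as a linear map. -/
def incl (n : ℕ) : SymMat n →ₗ[ℝ] Matrix (Fin n) (Fin n) ℝ where
  toFun A := A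
  map_add' _ _ := rfl
  map_smul' _ _ := rfl

lemma incl_injective (n : ℕ) : Function.Injective (incl n) := Subtype.val_injective

instance instFinDim (n : ℕ) : FiniteDimensional ℝ (SymMat n) :=
  FiniteDimensional.of_injective (incl n) (incl_injective n)

instance instContSMul (n : ℕ) : ContinuousSMul ℝ (SymMat n) :=
  Topology.IsInducing.continuousSMul (f := id) (g := incl n)
    Topology.IsInducing.subtypeVal continuous_id rfl

instance instLocConv (n : ℕ) : LocallyConvexSpace ℝ (SymMat n) := by
  haveI : LocallyConvexSpace ℝ (Matrix (Fin n) (Fin n) ℝ) :=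
    inferInstanceAs (LocallyConvexSpace ℝ (Fin n → Fin n → ℝ))
  exact LocallyConvexSpace.induced (incl n)

/-- The trace pairing as a bilinear map. -/
def tl (n : ℕ) : SymMat n →ₗ[ℝ] SymMat n →ₗ[ℝ] ℝ :=
  LinearMap.mk₂ ℝ (fun A B => tinner B A)
    (fun a b c => by simp [tinner, Matrix.mul_add])
    (fun a b c => by simp [tinner])
    (fun a b c => by simp [tinner, Matrix.add_mul])
    (fun a b c => by simp [tinner])

lemma tl_apply {n : ℕ} (A B : SymMat n) : tl n B A = tinner A B := rfl

lemma tl_surj {n : ℕ} : Function.Surjective (tl n) := by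
  rw [← LinearMap.injective_iff_surjective_of_finrank_eq_finrank
    (Subspace.dual_finrank_eq (K := ℝ) (V := SymMat n)).symm]
  rw [← LinearMap.ker_eq_bot, LinearMap.ker_eq_bot']
  intro A hA
  have h : tl n A A = 0 := by rw [hA]; rfl
  rw [tl_apply, tinner] at h
  have hs : (A : Matrix (Fin n) (Fin n) ℝ)ᴴ = A := A.2
  apply Subtype.ext
  have h2 : ((A : Matrix (Fin n) (Fin n) ℝ)ᴴ * (A : Matrix (Fin n) (Fin n) ℝ)).trace = 0 := by
    rw [hs]; exact h
  exact Matrix.trace_conjTranspose_mul_self_eq_zero_iff.1 h2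

lemma exists_tinner {n : ℕ} (f : SymMat n →ₗ[ℝ] ℝ) : ∃ B, ∀ A, f A = tinner A B := by
  obtain ⟨B, hB⟩ := tl_surj f
  exact ⟨B, fun A => by rw [← hB, tl_apply]⟩

/-- Trace as a linear functional. -/
def tr (n : ℕ) : SymMat n →ₗ[ℝ] ℝ := (Matrix.traceLinearMap (Fin n) ℝ ℝ).comp (incl n)

lemma tr_apply {n : ℕ} (A : SymMat n) : tr n A = (A : Matrix (Fin n) (Fin n) ℝ).trace := rfl

lemma lin_cont {n : ℕ} (f : SymMat n →ₗ[ℝ] ℝ) : Continuous f :=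
  LinearMap.continuous_of_finiteDimensional f

lemma psd_add {n : ℕ} {A B : SymMat n} (hA : A ∈ Psd n) (hB : B ∈ Psd n) : A + B ∈ Psd n :=
  Matrix.PosSemidef.add hA hB

lemma psd_smul {n : ℕ} {A : SymMat n} (hA : A ∈ Psd n) {t : ℝ} (ht : 0 ≤ t) : t • A ∈ Psd n :=
  Matrix.PosSemidef.smul hA ht

lemma psd_zero {n : ℕ} : (0 : SymMat n) ∈ Psd n := Matrix.PosSemidef.zero

lemma tr_nonneg {n : ℕ} {A : SymMat n} (hA : A ∈ Psd n) : 0 ≤ tr n A :=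
  Matrix.PosSemidef.trace_nonneg hA

lemma tr_eq_zero {n : ℕ} {A : SymMat n} (hA : A ∈ Psd n) (h : tr n A = 0) : A = 0 :=
  Subtype.ext ((Matrix.PosSemidef.trace_eq_zero_iff hA).1 h)

lemma psd_closed (n : ℕ) : IsClosed (Psd n) := by
  have : Psd n = ⋂ x : Fin n → ℝ,
      {A : SymMat n | 0 ≤ star x ⬝ᵥ (A : Matrix (Fin n) (Fin n) ℝ).mulVec x} := by
    ext A
    simp only [Psd, mem_setOf_eq, mem_iInter]
    rw [Matrix.posSemidef_iff_dotProduct_mulVec]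
    exact ⟨fun h => h.2, fun h => ⟨A.2, h⟩⟩
  rw [this]
  refine isClosed_iInter fun x => isClosed_le continuous_const ?_
  exact continuous_const.dotProduct (continuous_subtype_val.matrix_mulVec continuous_const)

lemma entry_bound {n : ℕ} {A : SymMat n} (hA : A ∈ Psd n) (i j : Fin n) :
    (A : Matrix (Fin n) (Fin n) ℝ) i j ∈ Icc (-(tr n A)) (tr n A) := by
  have hA' : (A : Matrix (Fin n) (Fin n) ℝ).PosSemidef := hA
  have hd : ∀ i, 0 ≤ (A : Matrix (Fin n) (Fin n) ℝ) i i := fun i => hA'.diag_nonneg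
  have hle : ∀ i, (A : Matrix (Fin n) (Fin n) ℝ) i i ≤ tr n A := fun i =>
    Finset.single_le_sum (f := fun i => (A : Matrix (Fin n) (Fin n) ℝ) i i)
      (fun i _ => hd i) (Finset.mem_univ i)
  have hs : (A : Matrix (Fin n) (Fin n) ℝ) j i = (A : Matrix (Fin n) (Fin n) ℝ) i j := by
    simpa using hA'.1.apply i j
  have h1 := hA'.dotProduct_mulVec_nonneg (Pi.single i 1 + Pi.single j 1)
  have h2 := hA'.dotProduct_mulVec_nonneg (Pi.single i 1 - Pi.single j 1)
  simp [Matrix.mulVec_add, Matrix.mulVec_sub] at h1 h2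
  have := hle i
  have := hle j
  constructor <;> linarith

lemma slice_compact (n : ℕ) (M : ℝ) : IsCompact {A : SymMat n | A ∈ Psd n ∧ tr n A ≤ M} := by
  have hbox : IsCompact (Set.pi univ fun _ : Fin n => Set.pi univ fun _ : Fin n => Icc (-M) M) :=
    isCompact_univ_pi fun _ => isCompact_univ_pi fun _ => isCompact_Icc
  have hcl : IsClosed {A : Matrix (Fin n) (Fin n) ℝ | star A = A} :=
    isClosed_eq continuous_star continuous_id
  have hemb : Topology.IsClosedEmbedding
      (Subtype.val : SymMat n → Matrix (Fin n) (Fin n) ℝ) := hcl.isClosedEmbedding_subtypeVal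
  refine (hemb.isCompact_preimage hbox).of_isClosed_subset
    ((psd_closed n).inter (isClosed_le (lin_cont (tr n)) continuous_const)) ?_
  rintro A ⟨hA, hM⟩
  intro i _ j _
  have := entry_bound hA i j
  exact ⟨by linarith [this.1], this.2.trans hM⟩

lemma base_compact (n : ℕ) : IsCompact {A : SymMat n | A ∈ Psd n ∧ tr n A = 1} := by
  refine (slice_compact n 1).of_isClosed_subset
    ((psd_closed n).inter (isClosed_eq (lin_cont (tr n)) continuous_const)) ?_
  rintro A ⟨hA, h⟩
  exact ⟨hA, h.le⟩

/-- lower bounds on the base propagate to the cone -/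
lemma base_bound {n : ℕ} (f : SymMat n →ₗ[ℝ] ℝ) (c : ℝ)
    (h : ∀ A ∈ Psd n, tr n A = 1 → c ≤ f A) (A : SymMat n) (hA : A ∈ Psd n) :
    c * tr n A ≤ f A := by
  rcases (tr_nonneg hA).eq_or_lt with h0 | h0
  · have := tr_eq_zero hA h0.symm
    subst this
    simp
  · have := h ((tr n A)⁻¹ • A) (psd_smul hA (by positivity)) (by
      rw [map_smul, smul_eq_mul, inv_mul_cancel₀ h0.ne'])
    rw [map_smul, smul_eq_mul] at this
    rw [inv_mul_eq_div, le_div_iff₀ h0] at this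
    exact this

lemma exists_sep {n : ℕ} (E : Submodule ℝ (SymMat n))
    (hE : (E : Set (SymMat n)) ∩ Psd n = {0}) :
    ∃ f : SymMat n →ₗ[ℝ] ℝ, ∃ c : ℝ, 0 < c ∧ (∀ A ∈ E, f A = 0) ∧
      ∀ A ∈ Psd n, c * tr n A ≤ f A := by
  obtain ⟨g, u, v, h1, huv, h2⟩ := geometric_hahn_banach_compact_closed
    (s := {A : SymMat n | A ∈ Psd n ∧ tr n A = 1}) (t := (E : Set (SymMat n)))
    (by
      rintro A ⟨hA, hA1⟩ B ⟨hB, hB1⟩ a b ha hb hab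
      refine ⟨psd_add (psd_smul hA ha) (psd_smul hB hb), ?_⟩
      simp [hA1, hB1, hab]) (base_compact n) E.convex (Submodule.closed_of_finiteDimensional E)
    (by
      rw [Set.disjoint_left]
      rintro A ⟨hA, hA1⟩ hAE
      have : A ∈ (E : Set (SymMat n)) ∩ Psd n := ⟨hAE, hA⟩
      rw [hE] at this
      rw [mem_singleton_iff.1 this] at hA1
      simp at hA1)
  have hv : v < 0 := by simpa using h2 0 E.zero_mem
  refine ⟨-(g : SymMat n →ₗ[ℝ] ℝ), -u, by linarith, ?_, ?_⟩
  · intro A hA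
    by_contra hne
    have hgA : g A ≠ 0 := by simpa using hne
    have := h2 ((v / g A) • A) (E.smul_mem _ hA)
    rw [map_smul, smul_eq_mul, div_mul_cancel₀ _ hgA] at this
    exact lt_irrefl _ this
  · refine base_bound _ _ ?_
    intro A hA hA1
    have := h1 A ⟨hA, hA1⟩
    simp only [LinearMap.neg_apply, ContinuousLinearMap.coe_coe]
    linarith

lemma sum_closed {n : ℕ} (E : Submodule ℝ (SymMat n)) (f : SymMat n →ₗ[ℝ] ℝ) (c : ℝ)
    (hc : 0 < c) (hf : ∀ A ∈ E, f A = 0) (hf2 : ∀ A ∈ Psd n, c * tr n A ≤ f A) :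
    IsClosed ((E : Set (SymMat n)) + Psd n) := by
  rw [← closure_subset_iff_isClosed]
  intro A hA
  set M := (f A + 1) / c with hM
  have hK : IsClosed ((E : Set (SymMat n)) + {A : SymMat n | A ∈ Psd n ∧ tr n A ≤ M}) :=
    (Submodule.closed_of_finiteDimensional E).add_right_of_isCompact (slice_compact n M)
  have hU : IsOpen {B : SymMat n | f B < f A + 1} := isOpen_lt (lin_cont f) continuous_const
  have hmem : A ∈ closure (((E : Set (SymMat n)) + Psd n) ∩ {B : SymMat n | f B < f A + 1}) := by
    rw [mem_closure_iff] at hA ⊢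
    intro o ho hAo
    obtain ⟨x, hx1, hx2⟩ := hA (o ∩ {B : SymMat n | f B < f A + 1}) (ho.inter hU)
      ⟨hAo, by simp⟩
    exact ⟨x, hx1.1, hx2, hx1.2⟩
  have hsub : ((E : Set (SymMat n)) + Psd n) ∩ {B : SymMat n | f B < f A + 1} ⊆
      (E : Set (SymMat n)) + {A : SymMat n | A ∈ Psd n ∧ tr n A ≤ M} := by
    rintro _ ⟨⟨e, he, p, hp, rfl⟩, hlt⟩
    refine ⟨e, he, p, ⟨hp, ?_⟩, rfl⟩
    simp only [mem_setOf_eq, map_add, hf e he, zero_add] at hlt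
    rw [hM, le_div_iff₀ hc]
    linarith [hf2 p hp]
  obtain ⟨e, he, p, hp, rfl⟩ := closure_minimal hsub hK hmem
  exact ⟨e, he, p, hp.1, rfl⟩

end SymMat

open SymMat in
theorem minimal_subequation {n : ℕ} (hn : 1 ≤ n) (E : Submodule ℝ (SymMat n))
    (hE : (E : Set (SymMat n)) ∩ Psd n = {0}) :
    IsSubequation ((E : Set (SymMat n)) + Psd n) ∧
    edge ((E : Set (SymMat n)) + Psd n) = (E : Set (SymMat n)) ∧
    ((Submodule.span ℝ (polarCone ((E : Set (SymMat n)) + Psd n)) : Submodule ℝ (SymMat n)) :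
        Set (SymMat n)) = orthSet (E : Set (SymMat n)) ∧
    ∀ Q : Set (SymMat n), IsSubequation Q → edge Q = (E : Set (SymMat n)) →
      (E : Set (SymMat n)) + Psd n ⊆ Q := by
  obtain ⟨f, c, hc, hf, hf2⟩ := exists_sep E hE
  have hfp : ∀ p ∈ Psd n, 0 ≤ f p := fun p hp =>
    (mul_nonneg hc.le (tr_nonneg hp)).trans (hf2 p hp)
  have hf0 : ∀ p ∈ Psd n, f p ≤ 0 → p = 0 := by
    intro p hp h
    refine tr_eq_zero hp (le_antisymm ?_ (tr_nonneg hp))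
    by_contra hlt
    push Not at hlt
    linarith [hf2 p hp, mul_pos hc hlt]
  have hEsub : ∀ e ∈ E, e ∈ (E : Set (SymMat n)) + Psd n := fun e he =>
    ⟨e, he, 0, psd_zero, add_zero e⟩
  refine ⟨⟨⟨0, hEsub 0 E.zero_mem⟩, ?_, sum_closed E f c hc hf hf2, ?_, ?_, ?_⟩, ?_, ?_, ?_⟩
  · intro huniv
    have hI : (1 : SymMat n) ∈ Psd n := Matrix.PosSemidef.one
    have : (-1 : SymMat n) ∈ (E : Set (SymMat n)) + Psd n := by rw [huniv]; trivial
    obtain ⟨e, he, p, hp, hep⟩ := this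
    have h1 : f (-1) = f p := by rw [← hep]; simp [hf e he]
    have h2 : f 1 ≤ 0 := by
      rw [map_neg] at h1
      linarith [hfp p hp]
    have h3 := hf0 1 hI h2
    have h4 := congrArg (fun A : SymMat n => (A : Matrix (Fin n) (Fin n) ℝ) ⟨0, hn⟩ ⟨0, hn⟩) h3
    simp at h4
  · rintro _ ⟨e, he, p, hp, rfl⟩ _ ⟨e', he', p', hp', rfl⟩ a b ha hb hab
    refine ⟨a • e + b • e', E.add_mem (E.smul_mem _ he) (E.smul_mem _ he'),
      a • p + b • p', psd_add (psd_smul hp ha) (psd_smul hp' hb), ?_⟩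
    simp only [smul_add]
    abel
  · rintro t ht _ ⟨e, he, p, hp, rfl⟩
    exact ⟨t • e, E.smul_mem _ he, t • p, psd_smul hp ht, (smul_add _ _ _).symm⟩
  · rintro _ ⟨e, he, p, hp, rfl⟩ q hq
    exact ⟨e, he, p + q, psd_add hp hq, (add_assoc _ _ _).symm⟩
  · apply Subset.antisymm
    · rintro _ ⟨⟨e, he, p, hp, rfl⟩, ⟨e', he', p', hp', h⟩⟩
      have h' := congrArg f h
      simp only [map_add, map_neg, hf e he, hf e' he'] at h'
      have hp0 : p = 0 := hf0 p hp (by linarith [hfp p' hp'])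
      subst hp0
      simpa using he
    · intro e he
      exact ⟨hEsub e he, hEsub (-e) (E.neg_mem he)⟩
  · obtain ⟨B, hB⟩ := exists_tinner f
    apply Subset.antisymm
    · let O : Submodule ℝ (SymMat n) :=
        { carrier := orthSet (E : Set (SymMat n))
          add_mem' := fun {a b} ha hb A hA => by
            have h1 := ha A hA
            have h2 := hb A hA
            rw [← tl_apply] at h1 h2 ⊢
            simp [h1, h2]
          zero_mem' := fun A _ => by rw [← tl_apply]; simp
          smul_mem' := fun t a ha A hA => by
            have h1 := ha A hA
            rw [← tl_apply] at h1 ⊢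
            simp [h1] }
      have : Submodule.span ℝ (polarCone ((E : Set (SymMat n)) + Psd n)) ≤ O := by
        rw [Submodule.span_le]
        intro X hX A hA
        have h1 := hX A (hEsub A hA)
        have h2 := hX (-A) (hEsub (-A) (E.neg_mem hA))
        rw [← tl_apply] at h1 h2 ⊢
        rw [map_neg] at h2
        linarith
      exact this
    · intro X hX
      obtain ⟨m, hm⟩ := (base_compact n).bddBelow_image (lin_cont (tl n X)).continuousOn
      have hX2 : ∀ p ∈ Psd n, m * tr n p ≤ tl n X p :=
        base_bound _ _ fun A hA hA1 => hm ⟨A, ⟨hA, hA1⟩, rfl⟩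
      have hBpol : B ∈ polarCone ((E : Set (SymMat n)) + Psd n) := by
        rintro _ ⟨e, he, p, hp, rfl⟩
        rw [← hB]
        simpa [hf e he] using hfp p hp
      have hXB : X + (|m| / c) • B ∈ polarCone ((E : Set (SymMat n)) + Psd n) := by
        rintro _ ⟨e, he, p, hp, rfl⟩
        have hXe : tl n X e = 0 := hX e he
        have hBe : tl n B e = 0 := (hB e).symm.trans (hf e he)
        have hBp : tl n B p = f p := (hB p).symm
        rw [← tl_apply]
        simp only [map_add, map_smul, LinearMap.add_apply, LinearMap.smul_apply, smul_eq_mul,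
          hXe, hBe, hBp]
        have h1 : (|m| / c) * (c * tr n p) ≤ (|m| / c) * f p :=
          mul_le_mul_of_nonneg_left (hf2 p hp) (by positivity)
        have h2 : (|m| / c) * (c * tr n p) = |m| * tr n p := by field_simp
        have h3 : -|m| * tr n p ≤ m * tr n p :=
          mul_le_mul_of_nonneg_right (neg_abs_le m) (tr_nonneg hp)
        linarith [hX2 p hp]
      have := Submodule.sub_mem _ (Submodule.subset_span (R := ℝ) hXB)
        (Submodule.smul_mem _ (|m| / c) (Submodule.subset_span (R := ℝ) hBpol))
      simpa using this
  · rintro Q hQ hQE _ ⟨e, he, p, hp, rfl⟩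
    have : e ∈ edge Q := by rw [hQE]; exact he
    exact hQ.positivity e this.1 p hp
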